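/- arXiv:2311.08939 — 2 statements merged into one kernel-verified Lean document; each statement's English description precedes it below -/
import Mathlib

section
/- Asymptotically, Ẽ_n / n! ∼ 4·(2/π)^{n+1} as n → ∞; that is, the limit as n → ∞ of (Ẽ_n / n!) · (π/2)^{n+1} equals 4, where Ẽ_n is the number of alternating permutations of {1,…,n}. -/
open scoped Classical

/-- Full plane binary trees with leaves labeled by natural numbers
(representing the variables `X_i`). -/
inductive BTree : Type where
  | leaf : ℕ → BTree
  | node : BTree → BTree → BTree

namespace BTree

/-- The list of leaf labels, from left to right. -/
def leaves : BTree → List ℕ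
  | leaf a => [a]
  | node l r => l.leaves ++ r.leaves

/-- The expansion set `W(T, ℓ)` of the commutator monomial modeled by `T`. -/
def words : BTree → Finset (List ℕ)
  | leaf a => {[a]}
  | node l r =>
      ((l.words ×ˢ r.words).image fun p => p.1 ++ p.2) ∪
      ((l.words ×ˢ r.words).image fun p => p.2 ++ p.1)

end BTree

/-- A word (list of labels) is alternating: consecutive entries differ, and no entry
lies strictly between its two neighbours. -/
def IsAlternating (w : List ℕ) : Prop :=
  (∀ i, i + 1 < w.length → w.getD i 0 ≠ w.getD (i + 1) 0) ∧
  (∀ i, i + 2 < w.length →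
    ¬ (w.getD i 0 < w.getD (i + 1) 0 ∧ w.getD (i + 1) 0 < w.getD (i + 2) 0) ∧
    ¬ (w.getD (i + 2) 0 < w.getD (i + 1) 0 ∧ w.getD (i + 1) 0 < w.getD i 0))

/-- A word is forward alternating: alternating, and it does not start with an ascent. -/
def IsForwardAlternating (w : List ℕ) : Prop :=
  IsAlternating w ∧ (w.length ≤ 1 ∨ w.getD 1 0 < w.getD 0 0)

/-- Number of alternating words in the expansion of `t`. -/
noncomputable def altCount (t : BTree) : ℕ :=
  (t.words.filter fun w => IsAlternating w).card

/-- Number of forward alternating words in the expansion of `t`. -/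
noncomputable def faltCount (t : BTree) : ℕ :=
  (t.words.filter fun w => IsForwardAlternating w).card

/-- `rAlt n` : the maximal number of alternating associative monomials in a commutator
monomial whose leaves are labeled bijectively by `{1, …, n}`. -/
noncomputable def rAlt (n : ℕ) : ℕ :=
  sSup {m | ∃ t : BTree, t.leaves.Perm (List.range' 1 n) ∧ m = altCount t}

/-- `rFAlt n` : the forward-alternating analogue of `rAlt n`. -/
noncomputable def rFAlt (n : ℕ) : ℕ :=
  sSup {m | ∃ t : BTree, t.leaves.Perm (List.range' 1 n) ∧ m = faltCount t}

/-- The number of alternating permutations of `{1, …, n}` (denoted `Ẽ_n`). -/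
noncomputable def altPerms (n : ℕ) : ℕ :=
  Nat.card {σ : Equiv.Perm (Fin n) // IsAlternating (List.ofFn fun i => (σ i : ℕ))}

/-- The number of forward alternating permutations of `{1, …, n}` (denoted `E_n`). -/
noncomputable def faltPerms (n : ℕ) : ℕ :=
  Nat.card {σ : Equiv.Perm (Fin n) // IsForwardAlternating (List.ofFn fun i => (σ i : ℕ))}

/-- Entringer numbers, counting the up-down permutations of `n + 1` letters that start at `a`. -/
def entringer : ℕ → ℕ → ℕ
  | 0, a => if a = 0 then 1 else 0
  | n + 1, a => ∑ c ∈ Finset.range (n + 1 - a), entringer n c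

theorem entringer_succ (n a : ℕ) :
    entringer (n + 1) a = ∑ c ∈ Finset.range (n + 1 - a), entringer n c := rfl

theorem entringer_succ_eq_add {n i j : ℕ} (h : i + j = n) :
    entringer (n + 1) i = entringer (n + 1) (i + 1) + entringer n j := by
  subst h
  rw [entringer_succ, entringer_succ, show i + j + 1 - i = j + 1 by omega,
    show i + j + 1 - (i + 1) = j by omega, Finset.sum_range_succ]

theorem hasDerivAt_pow_div_factorial (n : ℕ) (x : ℝ) :
    HasDerivAt (fun y : ℝ => y ^ (n + 1) / (n + 1).factorial) (x ^ n / n.factorial) x := by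
  refine ((hasDerivAt_pow (n + 1) x).div_const ((n + 1).factorial : ℝ)).congr_deriv ?_
  rw [Nat.factorial_succ]
  push_cast
  have : (n.factorial : ℝ) ≠ 0 := by positivity
  have : (n + 1 : ℝ) ≠ 0 := by positivity
  field_simp

theorem hasDerivAt_one_sub_pow_div_factorial (n : ℕ) (x : ℝ) :
    HasDerivAt (fun y : ℝ => (1 - y) ^ (n + 1) / (n + 1).factorial)
      (-((1 - x) ^ n / n.factorial)) x := by
  exact (hasDerivAt_pow_div_factorial n (1 - x)).comp_const_sub 1 x

/-- The polynomial with Bernstein coefficients given by the `n`-th row of Entringer numbers. -/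
noncomputable def entringerPoly (n : ℕ) (x : ℝ) : ℝ :=
  ∑ p ∈ Finset.HasAntidiagonal.antidiagonal n,
    (entringer n p.1 : ℝ) * (x ^ p.1 / p.1.factorial * ((1 - x) ^ p.2 / p.2.factorial))

theorem entringerPoly_zero_left (x : ℝ) : entringerPoly 0 x = 1 := by
  simp [entringerPoly, entringer]

theorem entringerPoly_apply_zero (n : ℕ) :
    entringerPoly n 0 = entringer n 0 / n.factorial := by
  cases n with
  | zero => simp [entringerPoly, entringer]
  | succ n => simp [entringerPoly, Finset.Nat.sum_antidiagonal_succ, div_eq_mul_inv]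

theorem entringerPoly_succ_apply_one (n : ℕ) : entringerPoly (n + 1) 1 = 0 := by
  simp [entringerPoly, Finset.Nat.sum_antidiagonal_succ', entringer]

theorem hasDerivAt_entringerPoly_succ (n : ℕ) (x : ℝ) :
    HasDerivAt (entringerPoly (n + 1)) (-entringerPoly n (1 - x)) x := by
  have hfun : entringerPoly (n + 1) = fun y : ℝ =>
      ∑ p ∈ Finset.HasAntidiagonal.antidiagonal (n + 1),
        (entringer (n + 1) p.1 : ℝ) *
          (y ^ p.1 / p.1.factorial * ((1 - y) ^ p.2 / p.2.factorial)) := rfl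
  let D : ℝ → ℕ → ℝ := fun y k => if k = 0 then 0 else y ^ (k - 1) / (k - 1).factorial
  have hD : ∀ k, HasDerivAt (fun y : ℝ => y ^ k / k.factorial) (D x k) x := by
    rintro (_ | k)
    · simpa [D] using hasDerivAt_const x (1 : ℝ)
    · simpa [D] using hasDerivAt_pow_div_factorial k x
  have hD' : ∀ k, HasDerivAt (fun y : ℝ => (1 - y) ^ k / k.factorial) (-D (1 - x) k) x := by
    rintro (_ | k)
    · simpa [D] using hasDerivAt_const x (1 : ℝ)
    · simpa [D] using hasDerivAt_one_sub_pow_div_factorial k x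
  have hswap : entringerPoly n (1 - x) = ∑ p ∈ Finset.HasAntidiagonal.antidiagonal n,
      (entringer n p.2 : ℝ) * ((1 - x) ^ p.2 / p.2.factorial * (x ^ p.1 / p.1.factorial)) := by
    rw [entringerPoly, ← Finset.Nat.sum_antidiagonal_swap]
    simp only [Prod.fst_swap, Prod.snd_swap, sub_sub_cancel]
  rw [hfun]
  refine (HasDerivAt.fun_sum fun p _ =>
    ((hD p.1).mul (hD' p.2)).const_mul (entringer (n + 1) p.1 : ℝ)).congr_deriv ?_
  simp only [mul_add, Finset.sum_add_distrib]
  rw [Finset.Nat.sum_antidiagonal_succ, Finset.Nat.sum_antidiagonal_succ',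
    hswap]
  simp only [D, if_true]
  simp only [Nat.add_one_ne_zero, if_false, zero_mul, mul_zero, zero_add, neg_zero,
    Nat.add_sub_cancel, ← Finset.sum_add_distrib, ← Finset.sum_neg_distrib]
  refine Finset.sum_congr rfl fun p hp => ?_
  rw [entringer_succ_eq_add (Finset.HasAntidiagonal.mem_antidiagonal.1 hp)]
  push_cast
  ring

theorem continuous_entringerPoly (n : ℕ) : Continuous (entringerPoly n) := by
  unfold entringerPoly
  fun_prop

/-- The integral operator whose leading eigenfunction is `x ↦ cos (π x / 2)`. -/
noncomputable def zigzagOp (f : ℝ → ℝ) (x : ℝ) : ℝ :=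
  Real.pi / 2 * ∫ t in (0 : ℝ)..1 - x, f t

theorem hasDerivAt_zigzagOp {f : ℝ → ℝ} (hf : Continuous f) (x : ℝ) :
    HasDerivAt (zigzagOp f) (-(Real.pi / 2 * f (1 - x))) x := by
  have h := (hf.integral_hasStrictDerivAt 0 (1 - x)).hasDerivAt
  exact ((h.comp_const_sub 1 x).const_mul (Real.pi / 2)).congr_deriv (mul_neg _ _)

theorem continuous_zigzagOp {f : ℝ → ℝ} (hf : Continuous f) : Continuous (zigzagOp f) :=
  continuous_iff_continuousAt.2 fun x => (hasDerivAt_zigzagOp hf x).continuousAt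

theorem zigzagOp_apply_one (f : ℝ → ℝ) : zigzagOp f 1 = 0 := by simp [zigzagOp]

theorem eq_zigzagOp {f g : ℝ → ℝ} (hf : Continuous f)
    (hg : ∀ x, HasDerivAt g (-(Real.pi / 2 * f (1 - x))) x) (h1 : g 1 = 0) :
    g = zigzagOp f := by
  have h : ∀ x, HasDerivAt (g - zigzagOp f) 0 x := fun x => by
    simpa using (hg x).sub (hasDerivAt_zigzagOp hf x)
  funext x
  have := is_const_of_deriv_eq_zero (fun y => (h y).differentiableAt) (fun y => (h y).deriv) x 1
  simp only [Pi.sub_apply, h1, zigzagOp_apply_one] at this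
  linarith

/-- The leading eigenfunction of `zigzagOp`. -/
noncomputable def qcos (x : ℝ) : ℝ := Real.cos (Real.pi / 2 * x)

theorem continuous_qcos : Continuous qcos := by
  unfold qcos
  fun_prop

theorem qcos_one_sub (x : ℝ) : qcos (1 - x) = Real.sin (Real.pi / 2 * x) := by
  rw [qcos, mul_sub, mul_one, Real.cos_pi_div_two_sub]

theorem hasDerivAt_qcos (x : ℝ) : HasDerivAt qcos (-(Real.pi / 2 * qcos (1 - x))) x := by
  have h := ((hasDerivAt_id x).const_mul (Real.pi / 2)).cos
  refine h.congr_deriv ?_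
  rw [qcos_one_sub]
  simp
  ring

theorem qcos_zero : qcos 0 = 1 := by simp [qcos]

theorem qcos_one : qcos 1 = 0 := by simp [qcos]

theorem qcos_le_one (x : ℝ) : qcos x ≤ 1 := Real.cos_le_one _

theorem qcos_le {x : ℝ} (hx : x ≤ 1) : qcos x ≤ Real.pi / 2 * (1 - x) := by
  have h := qcos_one_sub (1 - x)
  rw [sub_sub_cancel] at h
  rw [h]
  exact Real.sin_le (mul_nonneg (by positivity) (by linarith))

theorem one_sub_le_qcos {x : ℝ} (h0 : 0 ≤ x) (h1 : x ≤ 1) : 1 - x ≤ qcos x := by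
  have h := qcos_one_sub (1 - x)
  rw [sub_sub_cancel] at h
  have hpi := Real.pi_pos
  have := Real.mul_le_sin (x := Real.pi / 2 * (1 - x))
    (mul_nonneg (by positivity) (by linarith)) (by nlinarith)
  rw [h]
  refine le_trans (le_of_eq ?_) this
  field_simp

theorem qcos_nonneg {x : ℝ} (h0 : 0 ≤ x) (h1 : x ≤ 1) : 0 ≤ qcos x :=
  (sub_nonneg.2 h1).trans (one_sub_le_qcos h0 h1)

theorem zigzagOp_qcos : zigzagOp qcos = qcos :=
  (eq_zigzagOp continuous_qcos hasDerivAt_qcos qcos_one).symm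

theorem hasDerivAt_qcos_one_sub (x : ℝ) :
    HasDerivAt (fun y => qcos (1 - y)) (Real.pi / 2 * qcos x) x := by
  simpa using (hasDerivAt_qcos (1 - x)).comp_const_sub 1 x

theorem integral_zigzagOp_mul_qcos {f : ℝ → ℝ} (hf : Continuous f) :
    ∫ x in (0 : ℝ)..1, zigzagOp f x * qcos x = ∫ x in (0 : ℝ)..1, f x * qcos x := by
  have hc := continuous_qcos
  have hpi := Real.pi_pos
  have key := intervalIntegral.integral_mul_deriv_eq_deriv_mul (a := 0) (b := 1)
    (fun x _ => hasDerivAt_zigzagOp hf x) (fun x _ => hasDerivAt_qcos_one_sub x)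
    (Continuous.intervalIntegrable (by fun_prop) _ _)
    (Continuous.intervalIntegrable (by fun_prop) _ _)
  have hsub := intervalIntegral.integral_comp_sub_left (a := 0) (b := 1)
    (fun x => Real.pi / 2 * (f x * qcos x)) 1
  simp only [zigzagOp_apply_one, sub_zero, qcos_one, sub_self, zero_mul, mul_zero, zero_sub,
    neg_mul, intervalIntegral.integral_neg, neg_neg] at key hsub
  have h1 : ∀ x, zigzagOp f x * (Real.pi / 2 * qcos x)
      = Real.pi / 2 * (zigzagOp f x * qcos x) := fun x => by ring
  simp only [h1, mul_assoc] at key hsub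
  simp only [intervalIntegral.integral_const_mul] at key hsub
  rw [hsub] at key
  exact mul_left_cancel₀ (by positivity) (mul_left_cancel₀ two_ne_zero (by linarith))

theorem integral_qcos : ∫ x in (0 : ℝ)..1, qcos x = 2 / Real.pi := by
  have h := congrFun zigzagOp_qcos 0
  simp only [zigzagOp, sub_zero, qcos_zero] at h
  have hpi := Real.pi_pos
  field_simp
  linarith

theorem integral_qcos_mul_qcos : ∫ x in (0 : ℝ)..1, qcos x * qcos x = 1 / 2 := by
  have hc := continuous_qcos
  have h1 := intervalIntegral.integral_comp_sub_left (a := 0) (b := 1)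
    (fun x => qcos x * qcos x) 1
  have h2 : ∫ x in (0 : ℝ)..1, (qcos x * qcos x + qcos (1 - x) * qcos (1 - x)) = 1 := by
    have : ∀ x, qcos x * qcos x + qcos (1 - x) * qcos (1 - x) = 1 := fun x => by
      rw [qcos_one_sub, qcos]
      nlinarith [Real.sin_sq_add_cos_sq (Real.pi / 2 * x)]
    simp [this]
  rw [intervalIntegral.integral_add (Continuous.intervalIntegrable (by fun_prop) _ _)
    (Continuous.intervalIntegrable (by fun_prop) _ _)] at h2
  simp only [sub_self, sub_zero] at h1
  linarith

theorem zigzagOp_nonneg {f : ℝ → ℝ} (h : ∀ x ∈ Set.Icc (0 : ℝ) 1, 0 ≤ f x) :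
    ∀ x ∈ Set.Icc (0 : ℝ) 1, 0 ≤ zigzagOp f x := fun x hx => by
  have := Real.pi_pos
  refine mul_nonneg (by positivity) (intervalIntegral.integral_nonneg (by linarith [hx.2]) ?_)
  exact fun t ht => h t ⟨ht.1, by linarith [ht.2, hx.1]⟩

theorem antitoneOn_zigzagOp {f : ℝ → ℝ} (hf : Continuous f)
    (h : ∀ x ∈ Set.Icc (0 : ℝ) 1, 0 ≤ f x) : AntitoneOn (zigzagOp f) (Set.Icc 0 1) := by
  have := Real.pi_pos
  refine antitoneOn_of_deriv_nonpos (convex_Icc 0 1) (continuous_zigzagOp hf).continuousOn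
    (fun x _ => (hasDerivAt_zigzagOp hf x).differentiableAt.differentiableWithinAt) fun x hx => ?_
  rw [interior_Icc] at hx
  rw [(hasDerivAt_zigzagOp hf x).deriv, neg_nonpos]
  exact mul_nonneg (by positivity) (h _ ⟨by linarith [hx.2], by linarith [hx.1]⟩)

theorem mul_integral_le_integral_of_antitoneOn {F : ℝ → ℝ} (hF : Continuous F)
    (hanti : AntitoneOn F (Set.Icc 0 1)) {a : ℝ} (h0 : 0 ≤ a) (h1 : a ≤ 1) :
    a * ∫ x in (0 : ℝ)..1, F x ≤ ∫ x in (0 : ℝ)..a, F x := by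
  have h := intervalIntegral.smul_integral_comp_mul_left (a := 0) (b := 1) F a
  simp only [mul_zero, mul_one, smul_eq_mul] at h
  rw [← h]
  refine mul_le_mul_of_nonneg_left ?_ h0
  refine intervalIntegral.integral_mono_on zero_le_one (hF.intervalIntegrable _ _)
    (Continuous.intervalIntegrable (by fun_prop) _ _) fun x hx => ?_
  have hax : a * x ≤ x := by nlinarith [hx.1]
  exact hanti ⟨mul_nonneg h0 hx.1, hax.trans hx.2⟩ hx hax

theorem integral_mul_qcos_mul_qcos_le {f : ℝ → ℝ} (hf : Continuous f)
    (h : ∀ x ∈ Set.Icc (0 : ℝ) 1, 0 ≤ f x) {x : ℝ} (hx : x ∈ Set.Icc (0 : ℝ) 1) :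
    (∫ t in (0 : ℝ)..1, f t * qcos t) * qcos x ≤ zigzagOp (zigzagOp f) x := by
  have hpi := Real.pi_pos
  have hc := continuous_qcos
  have hS := continuous_zigzagOp hf
  have hSnn := zigzagOp_nonneg h
  have hle : ∫ t in (0 : ℝ)..1, f t * qcos t ≤ ∫ t in (0 : ℝ)..1, zigzagOp f t := by
    rw [← integral_zigzagOp_mul_qcos hf]
    refine intervalIntegral.integral_mono_on zero_le_one
      (Continuous.intervalIntegrable (by fun_prop) _ _) (hS.intervalIntegrable _ _) fun t ht => ?_
    nlinarith [hSnn t ht, qcos_le_one t]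
  have hnn : 0 ≤ ∫ t in (0 : ℝ)..1, f t * qcos t :=
    intervalIntegral.integral_nonneg zero_le_one fun t ht =>
      mul_nonneg (h t ht) (qcos_nonneg ht.1 ht.2)
  have hx' : 0 ≤ 1 - x := by linarith [hx.2]
  calc (∫ t in (0 : ℝ)..1, f t * qcos t) * qcos x
      ≤ (∫ t in (0 : ℝ)..1, f t * qcos t) * (Real.pi / 2 * (1 - x)) :=
        mul_le_mul_of_nonneg_left (qcos_le hx.2) hnn
    _ ≤ (∫ t in (0 : ℝ)..1, zigzagOp f t) * (Real.pi / 2 * (1 - x)) :=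
        mul_le_mul_of_nonneg_right hle (by positivity)
    _ = Real.pi / 2 * ((1 - x) * ∫ t in (0 : ℝ)..1, zigzagOp f t) := by ring
    _ ≤ zigzagOp (zigzagOp f) x :=
        mul_le_mul_of_nonneg_left (mul_integral_le_integral_of_antitoneOn hS
          (antitoneOn_zigzagOp hf h) hx' (by linarith [hx.1])) (by positivity)

theorem zigzagOp_const_mul_qcos_add_const_mul {r : ℝ → ℝ} (hr : Continuous r) (D s : ℝ) :
    zigzagOp (fun x => D * qcos x + s * r x) = fun x => D * qcos x + s * zigzagOp r x := by
  have hc := continuous_qcos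
  funext x
  conv_rhs => rw [← zigzagOp_qcos]
  simp only [zigzagOp]
  rw [intervalIntegral.integral_add (Continuous.intervalIntegrable (by fun_prop) _ _)
    (Continuous.intervalIntegrable (by fun_prop) _ _), intervalIntegral.integral_const_mul,
    intervalIntegral.integral_const_mul]
  ring

theorem abs_zigzagOp_le {r : ℝ → ℝ} (hr : Continuous r) {D : ℝ}
    (h : ∀ x ∈ Set.Icc (0 : ℝ) 1, |r x| ≤ D * qcos x) :
    ∀ x ∈ Set.Icc (0 : ℝ) 1, |zigzagOp r x| ≤ D * qcos x := fun x hx => by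
  have key : ∀ s : ℝ, |s| = 1 → 0 ≤ D * qcos x + s * zigzagOp r x := fun s hs => by
    have := zigzagOp_nonneg (f := fun x => D * qcos x + s * r x) (fun y hy => by
      have h1 := neg_abs_le (s * r y)
      rw [abs_mul, hs, one_mul] at h1
      linarith [h y hy]) x hx
    rwa [zigzagOp_const_mul_qcos_add_const_mul hr] at this
  have h1 := key 1 (by simp)
  have h2 := key (-1) (by simp)
  rw [abs_le]
  constructor <;> linarith

theorem abs_zigzagOp_zigzagOp_le {r : ℝ → ℝ} (hr : Continuous r) {D : ℝ}
    (horth : ∫ x in (0 : ℝ)..1, r x * qcos x = 0)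
    (h : ∀ x ∈ Set.Icc (0 : ℝ) 1, |r x| ≤ D * qcos x) :
    ∀ x ∈ Set.Icc (0 : ℝ) 1, |zigzagOp (zigzagOp r) x| ≤ D / 2 * qcos x := fun x hx => by
  have hc := continuous_qcos
  have key : ∀ s : ℝ, |s| = 1 →
      D / 2 * qcos x ≤ D * qcos x + s * zigzagOp (zigzagOp r) x := fun s hs => by
    have := integral_mul_qcos_mul_qcos_le (f := fun x => D * qcos x + s * r x) (by fun_prop)
      (fun y hy => by
        have h1 := neg_abs_le (s * r y)
        rw [abs_mul, hs, one_mul] at h1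
        linarith [h y hy]) hx
    rw [zigzagOp_const_mul_qcos_add_const_mul hr,
      zigzagOp_const_mul_qcos_add_const_mul (continuous_zigzagOp hr)] at this
    simp only [add_mul, mul_assoc] at this
    rw [intervalIntegral.integral_add (Continuous.intervalIntegrable (by fun_prop) _ _)
      (Continuous.intervalIntegrable (by fun_prop) _ _), intervalIntegral.integral_const_mul,
      intervalIntegral.integral_const_mul, horth, integral_qcos_mul_qcos] at this
    linarith
  have h1 := key 1 (by simp)
  have h2 := key (-1) (by simp)
  rw [abs_le]
  constructor <;> linarith

/-- The deviation of the rescaled Entringer polynomial from its limit `2 cos (π x / 2)`. -/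
noncomputable def entringerError (n : ℕ) (x : ℝ) : ℝ :=
  (Real.pi / 2) ^ (n + 1) * entringerPoly n x - 2 * qcos x

theorem continuous_entringerError (n : ℕ) : Continuous (entringerError n) := by
  have h1 := continuous_qcos
  have h2 := continuous_entringerPoly n
  unfold entringerError
  fun_prop

theorem zigzagOp_entringerError (n : ℕ) :
    zigzagOp (entringerError n) = entringerError (n + 1) := by
  refine (eq_zigzagOp (continuous_entringerError n) (fun x => ?_) ?_).symm
  · refine (((hasDerivAt_entringerPoly_succ n x).const_mul ((Real.pi / 2) ^ (n + 1 + 1))).sub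
      ((hasDerivAt_qcos x).const_mul 2)).congr_deriv ?_
    rw [entringerError]
    ring
  · simp [entringerError, entringerPoly_succ_apply_one, qcos_one]

theorem integral_entringerError_mul_qcos (n : ℕ) :
    ∫ x in (0 : ℝ)..1, entringerError n x * qcos x = 0 := by
  have hc := continuous_qcos
  have hpi := Real.pi_pos
  induction n with
  | zero =>
    simp only [entringerError, entringerPoly_zero_left, sub_mul, mul_assoc]
    rw [intervalIntegral.integral_sub (Continuous.intervalIntegrable (by fun_prop) _ _)
      (Continuous.intervalIntegrable (by fun_prop) _ _)]
    simp only [intervalIntegral.integral_const_mul, integral_qcos_mul_qcos, one_mul, integral_qcos]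
    field_simp
    ring
  | succ n ih =>
    rw [← zigzagOp_entringerError, integral_zigzagOp_mul_qcos (continuous_entringerError n), ih]

theorem abs_entringerError_one_le {x : ℝ} (hx : x ∈ Set.Icc (0 : ℝ) 1) :
    |entringerError 1 x| ≤ 4 * qcos x := by
  have hpi := Real.pi_pos
  have h1 := one_sub_le_qcos hx.1 hx.2
  have h2 : 0 ≤ 1 - x := by linarith [hx.2]
  have h3 : (Real.pi / 2) ^ 2 ≤ 4 := by nlinarith [Real.pi_le_four]
  have h4 : entringerPoly 1 x = 1 - x := by
    simp [entringerPoly, Finset.Nat.sum_antidiagonal_succ, entringer]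
  rw [entringerError, h4, abs_le]
  norm_num only
  constructor <;> nlinarith [mul_nonneg (sq_nonneg (Real.pi / 2)) h2]

theorem abs_entringerError_le (n : ℕ) : ∀ x ∈ Set.Icc (0 : ℝ) 1,
    |entringerError (n + 1) x| ≤ 4 * (1 / 2) ^ (n / 2) * qcos x := by
  induction n using Nat.twoStepInduction with
  | zero => simpa using fun x h0 h1 => abs_entringerError_one_le ⟨h0, h1⟩
  | one =>
    rw [← zigzagOp_entringerError]
    simpa using abs_zigzagOp_le (continuous_entringerError 1) fun x => abs_entringerError_one_le
  | more n ih _ =>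
    intro x hx
    rw [← zigzagOp_entringerError, ← zigzagOp_entringerError]
    have := abs_zigzagOp_zigzagOp_le (continuous_entringerError _)
      (integral_entringerError_mul_qcos _) ih x hx
    rw [show (n + 2) / 2 = n / 2 + 1 by omega, pow_succ]
    linarith

theorem tendsto_entringer :
    Filter.Tendsto (fun n : ℕ => (Real.pi / 2) ^ (n + 1) * (entringer n 0 / n.factorial : ℝ))
      Filter.atTop (nhds 2) := by
  rw [← Filter.tendsto_add_atTop_iff_nat 1, ← tendsto_sub_nhds_zero_iff]
  have hlim : Filter.Tendsto (fun n : ℕ => 4 * (1 / 2 : ℝ) ^ (n / 2)) Filter.atTop (nhds 0) := by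
    have := ((tendsto_pow_atTop_nhds_zero_of_lt_one (r := (1 / 2 : ℝ)) (by norm_num)
      (by norm_num)).comp (Nat.tendsto_div_const_atTop two_ne_zero)).const_mul 4
    simpa using this
  refine squeeze_zero_norm (fun n => ?_) hlim
  have := abs_entringerError_le n 0 (by simp)
  simpa [entringerError, entringerPoly_apply_zero, qcos_zero] using this

/-- `IsZigzag up w` says that `w` is alternating and starts with an ascent if `up` is `true`,
with a descent otherwise. -/
def IsZigzag : Bool → List ℕ → Prop
  | _, [] => True
  | _, [_] => True
  | up, a :: b :: l => (if up then a < b else b < a) ∧ IsZigzag (!up) (b :: l)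

theorem isZigzag_cons_cons (up : Bool) (a b : ℕ) (l : List ℕ) :
    IsZigzag up (a :: b :: l) ↔ (if up then a < b else b < a) ∧ IsZigzag (!up) (b :: l) :=
  Iff.rfl

theorem isAlternating_cons_cons_cons (a b c : ℕ) (l : List ℕ) :
    IsAlternating (a :: b :: c :: l) ↔
      (a ≠ b ∧ ¬ (a < b ∧ b < c) ∧ ¬ (c < b ∧ b < a)) ∧ IsAlternating (b :: c :: l) := by
  constructor
  · rintro ⟨h1, h2⟩
    refine ⟨⟨by simpa using h1 0, by simpa using (h2 0 (by simp)).1,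
      by simpa using (h2 0 (by simp)).2⟩, fun i hi => ?_, fun i hi => ?_⟩
    · simpa using h1 (i + 1) (by simpa using hi)
    · simpa using h2 (i + 1) (by simpa using hi)
  · rintro ⟨⟨h1, h2, h3⟩, h4, h5⟩
    refine ⟨fun i hi => ?_, fun i hi => ?_⟩
    · cases i with
      | zero => simpa using h1
      | succ i => simpa using h4 i (by simpa using hi)
    · cases i with
      | zero => exact ⟨by simpa using h2, by simpa using h3⟩
      | succ i => simpa using h5 i (by simpa using hi)

theorem isAlternating_iff (w : List ℕ) :
    IsAlternating w ↔ IsZigzag true w ∨ IsZigzag false w := by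
  match w with
  | [] => simp [IsAlternating, IsZigzag]
  | [a] => simp [IsAlternating, IsZigzag]
  | [a, b] => simp [IsAlternating, IsZigzag]
  | a :: b :: c :: l =>
    rw [isAlternating_cons_cons_cons, isAlternating_iff (b :: c :: l)]
    simp only [isZigzag_cons_cons, Bool.not_true, Bool.not_false, if_true, Bool.false_eq_true,
      if_false]
    grind

theorem isZigzag_map {φ : ℕ → ℕ} (hφ : StrictMono φ) (up : Bool) (w : List ℕ) :
    IsZigzag up (w.map φ) ↔ IsZigzag up w := by
  match w with
  | [] => rfl
  | [a] => rfl
  | a :: b :: l =>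
    have ih := isZigzag_map hφ (!up) (b :: l)
    simp only [List.map_cons, isZigzag_cons_cons, hφ.lt_iff_lt] at ih ⊢
    rw [ih]

/-- The permutation of `Fin (n + 1)` with first value `a` whose other values are ordered as
those of `τ`. -/
def permCons {n : ℕ} (a : Fin (n + 1)) (τ : Equiv.Perm (Fin n)) : Equiv.Perm (Fin (n + 1)) :=
  (finSuccEquiv' 0).trans (τ.optionCongr.trans (finSuccEquiv' a).symm)

theorem permCons_zero {n : ℕ} (a : Fin (n + 1)) (τ : Equiv.Perm (Fin n)) :
    permCons a τ 0 = a := by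
  simp [permCons]

theorem permCons_succ {n : ℕ} (a : Fin (n + 1)) (τ : Equiv.Perm (Fin n)) (i : Fin n) :
    permCons a τ i.succ = a.succAbove (τ i) := by
  have h : finSuccEquiv' 0 i.succ = some i := by
    rw [← Fin.zero_succAbove, finSuccEquiv'_succAbove]
  simp [permCons, h]

theorem permCons_bijective (n : ℕ) :
    Function.Bijective fun p : Fin (n + 1) × Equiv.Perm (Fin n) => permCons p.1 p.2 := by
  rw [Fintype.bijective_iff_injective_and_card]
  constructor
  · rintro ⟨a, τ⟩ ⟨b, ρ⟩ h
    have hab : a = b := by simpa [permCons_zero] using DFunLike.congr_fun h 0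
    subst hab
    congr 1
    ext1 i
    simpa [permCons_succ] using DFunLike.congr_fun h i.succ
  · simp [Fintype.card_perm, Nat.factorial_succ]

/-- The number of permutations of `Fin (n + 1)` with first value `a` that zigzag. -/
noncomputable def zigzagCount (up : Bool) (n : ℕ) (a : Fin (n + 1)) : ℕ :=
  (Finset.univ.filter fun σ : Equiv.Perm (Fin (n + 1)) =>
    IsZigzag up (List.ofFn fun i => (σ i : ℕ)) ∧ σ 0 = a).card

theorem isZigzag_permCons (up : Bool) {n : ℕ} (a : Fin (n + 2)) (τ : Equiv.Perm (Fin (n + 1))) :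
    IsZigzag up (List.ofFn fun i => (permCons a τ i : ℕ)) ↔
      (if up then (a : ℕ) ≤ τ 0 else (τ 0 : ℕ) < a) ∧
        IsZigzag (!up) (List.ofFn fun i => (τ i : ℕ)) := by
  have hφ : StrictMono fun m : ℕ => if m < a then m else m + 1 := by
    intro x y hxy
    dsimp only
    split_ifs <;> omega
  have hval : ∀ i, ((a.succAbove (τ i) : Fin (n + 2)) : ℕ)
      = (fun m : ℕ => if m < a then m else m + 1) (τ i) := fun i => by
    simp only [Fin.succAbove, Fin.lt_def, Fin.val_castSucc]
    split_ifs <;> simp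
  rw [List.ofFn_succ, permCons_zero]
  simp only [permCons_succ, hval]
  have hmap : (List.ofFn fun i => (fun m : ℕ => if m < a then m else m + 1) (τ i))
      = (List.ofFn fun i => (τ i : ℕ)).map fun m : ℕ => if m < a then m else m + 1 := by
    rw [List.map_ofFn]
    rfl
  rw [hmap, ← isZigzag_map hφ (!up), List.ofFn_succ, List.map_cons, isZigzag_cons_cons]
  refine and_congr_left fun _ => ?_
  cases up <;> simp <;> split_ifs <;> omega

theorem card_filter_isZigzag (up : Bool) (n : ℕ) (s : Finset (Fin (n + 1))) :
    (Finset.univ.filter fun σ : Equiv.Perm (Fin (n + 1)) =>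
      IsZigzag up (List.ofFn fun i => (σ i : ℕ)) ∧ σ 0 ∈ s).card = ∑ b ∈ s, zigzagCount up n b := by
  rw [Finset.card_eq_sum_card_fiberwise (f := fun σ : Equiv.Perm (Fin (n + 1)) => σ 0) (t := s)
    (fun σ hσ => by simpa using (Finset.mem_filter.1 hσ).2.2)]
  refine Finset.sum_congr rfl fun b hb => ?_
  rw [zigzagCount, Finset.filter_filter]
  congr 1
  ext σ
  simp only [Finset.mem_filter, Finset.mem_univ, true_and]
  constructor
  · rintro ⟨⟨h1, _⟩, h2⟩
    exact ⟨h1, h2⟩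
  · rintro ⟨h1, rfl⟩
    exact ⟨⟨h1, hb⟩, rfl⟩

theorem zigzagCount_succ (up : Bool) (n : ℕ) (a : Fin (n + 2)) :
    zigzagCount up (n + 1) a =
      ∑ b ∈ Finset.univ.filter fun b : Fin (n + 1) => if up then (a : ℕ) ≤ b else (b : ℕ) < a,
        zigzagCount (!up) n b := by
  rw [← card_filter_isZigzag, zigzagCount]
  symm
  refine Finset.card_bij (fun τ _ => permCons a τ) (fun τ hτ => ?_) (fun τ _ ρ _ h => ?_)
    fun σ hσ => ?_
  · simp only [Finset.mem_filter, Finset.mem_univ, true_and] at hτ ⊢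
    exact ⟨(isZigzag_permCons up a τ).2 hτ.symm, permCons_zero a τ⟩
  · exact (Prod.ext_iff.1 ((permCons_bijective (n + 1)).1 (a₁ := (a, τ)) (a₂ := (a, ρ)) h)).2
  · obtain ⟨⟨b, τ⟩, rfl⟩ := (permCons_bijective (n + 1)).2 σ
    simp only [Finset.mem_filter, Finset.mem_univ, true_and, permCons_zero] at hσ
    obtain ⟨h, rfl⟩ := hσ
    refine ⟨τ, ?_, rfl⟩
    simp only [Finset.mem_filter, Finset.mem_univ, true_and]
    exact ((isZigzag_permCons up b τ).1 h).symm

theorem sum_filter_lt_entringer (n m : ℕ) (hm : m ≤ n + 1) :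
    ∑ b ∈ Finset.univ.filter fun b : Fin (n + 1) => (b : ℕ) < m, entringer n b =
      entringer (n + 1) (n + 1 - m) := by
  rw [entringer_succ, Nat.sub_sub_self hm, Finset.sum_filter,
    Fin.sum_univ_eq_sum_range fun b => if b < m then entringer n b else 0, ← Finset.sum_filter]
  congr 1
  ext b
  simp
  omega

theorem zigzagCount_eq (n : ℕ) : ∀ a : Fin (n + 1),
    zigzagCount true n a = entringer n a ∧ zigzagCount false n a = entringer n a.rev := by
  induction n with
  | zero =>
    intro a
    rw [Fin.fin_one_eq_zero a]
    simp [zigzagCount, entringer, IsZigzag, Finset.filter_singleton]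
  | succ n ih =>
    intro a
    rw [zigzagCount_succ, zigzagCount_succ]
    simp only [Bool.not_true, Bool.not_false, if_true, Bool.false_eq_true, if_false, ih]
    constructor
    · have h := sum_filter_lt_entringer n (n + 1 - a) (by omega)
      rw [Nat.sub_sub_self (by omega)] at h
      rw [← h]
      refine Finset.sum_equiv Fin.revPerm (fun b => ?_) fun b _ => rfl
      simp only [Finset.mem_filter, Finset.mem_univ, true_and, Fin.revPerm_apply, Fin.val_rev]
      omega
    · rw [sum_filter_lt_entringer n a (by omega), Fin.val_rev]
      congr 1
      omega

theorem altPerms_eq_two_mul_entringer (n : ℕ) : altPerms (n + 2) = 2 * entringer (n + 2) 0 := by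
  have h (up : Bool) : (Finset.univ.filter fun σ : Equiv.Perm (Fin (n + 2)) =>
      IsZigzag up (List.ofFn fun i => (σ i : ℕ))).card = entringer (n + 2) 0 := by
    have h1 := card_filter_isZigzag up (n + 1) Finset.univ
    simp only [Finset.mem_univ, and_true] at h1
    have h2 := sum_filter_lt_entringer (n + 1) (n + 2) le_rfl
    simp only [Fin.is_lt, Finset.filter_true, Nat.sub_self] at h2
    rw [h1, ← h2]
    cases up
    · simp only [zigzagCount_eq]
      exact Equiv.sum_comp Fin.revPerm fun b : Fin (n + 2) => entringer (n + 1) b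
    · simp only [zigzagCount_eq]
  rw [altPerms, Nat.card_eq_fintype_card, Fintype.card_subtype]
  simp only [isAlternating_iff]
  rw [Finset.filter_or, Finset.card_union_of_disjoint, h, h, two_mul]
  rw [Finset.disjoint_filter]
  intro σ _
  rw [List.ofFn_succ, List.ofFn_succ, isZigzag_cons_cons, isZigzag_cons_cons]
  simp only [if_true, Bool.false_eq_true, if_false]
  omega

/-- Asymptotically `Ẽ_n / n! ∼ 4 (2/π)^{n+1}`. -/
theorem altPerms_asymptotics :
    Filter.Tendsto
      (fun n : ℕ => ((altPerms n : ℝ) / (Nat.factorial n)) * (Real.pi / 2) ^ (n + 1))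
      Filter.atTop (nhds 4) := by
  have h := tendsto_entringer.const_mul 2
  rw [show (2 * 2 : ℝ) = 4 by norm_num] at h
  refine h.congr' ?_
  filter_upwards [Filter.eventually_ge_atTop 2] with n hn
  obtain ⟨m, rfl⟩ := Nat.exists_eq_add_of_le' hn
  rw [altPerms_eq_two_mul_entringer]
  push_cast
  ring
end

section
/- For every n ≥ 1 and every full binary tree T with n leaves, the sum over all n! bijective labelings ℓ of the leaves of T by {1,…,n} of the number of alternating words in W(T,ℓ) equals 2^{n−1} · Ẽ_n. Equivalently, the expected number of alternating associative monomials in the expansion of a commutator monomial of shape T, averaged over the permutations of the variables X_1,…,X_n, equals 2^{n−1} · Ẽ_n / n!. -/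
open scoped Classical

namespace BTree

/-- Apply a function to all leaf labels of a tree. -/
def relabel (f : ℕ → ℕ) : BTree → BTree
  | leaf a => leaf (f a)
  | node l r => node (l.relabel f) (r.relabel f)

end BTree

/-- The relabeling of `{1,…,n}` induced by a permutation of `Fin n`
(sending `a ∈ {1,…,n}` to `σ(a-1)+1`). -/
def permRelabel {n : ℕ} (σ : Equiv.Perm (Fin n)) (a : ℕ) : ℕ :=
  if h : a - 1 < n then (σ ⟨a - 1, h⟩ : ℕ) + 1 else a

namespace BTree

theorem leaves_ne_nil (t : BTree) : t.leaves ≠ [] := by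
  induction t with
  | leaf a => simp [leaves]
  | node l r ihl _ => simp [leaves, ihl]

theorem perm_leaves_of_mem_words {t : BTree} {w : List ℕ} (hw : w ∈ t.words) :
    w.Perm t.leaves := by
  induction t generalizing w with
  | leaf a => simp_all [words, leaves]
  | node l r ihl ihr =>
    simp only [words, Finset.mem_union, Finset.mem_image, Finset.mem_product, Prod.exists] at hw
    rcases hw with ⟨u, v, ⟨hu, hv⟩, rfl⟩ | ⟨u, v, ⟨hu, hv⟩, rfl⟩
    · exact (ihl hu).append (ihr hv)
    · exact List.perm_append_comm.trans ((ihl hu).append (ihr hv))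

theorem two_mul_card_words {t : BTree} (h : t.leaves.Nodup) :
    2 * t.words.card = 2 ^ t.leaves.length := by
  induction t with
  | leaf a => simp [words, leaves]
  | node l r ihl ihr =>
    obtain ⟨hl, hr, hd⟩ := List.nodup_append'.1 h
    have hdisj : Disjoint ((l.words ×ˢ r.words).image fun p => p.1 ++ p.2)
        ((l.words ×ˢ r.words).image fun p => p.2 ++ p.1) := by
      rw [Finset.disjoint_left]
      intro w hw hw'
      simp only [Finset.mem_image, Finset.mem_product, Prod.exists] at hw hw'
      obtain ⟨u, v, ⟨hu, hv⟩, rfl⟩ := hw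
      obtain ⟨u', v', ⟨hu', hv'⟩, h'⟩ := hw'
      have pu := perm_leaves_of_mem_words hu
      have pv' := perm_leaves_of_mem_words hv'
      cases u with
      | nil => exact l.leaves_ne_nil pu.symm.eq_nil
      | cons a u =>
        cases v' with
        | nil => exact r.leaves_ne_nil pv'.symm.eq_nil
        | cons b v' =>
          simp only [List.cons_append, List.cons.injEq] at h'
          obtain ⟨rfl, -⟩ := h'
          exact hd (pu.subset List.mem_cons_self) (pv'.subset List.mem_cons_self)
    rw [words, Finset.card_union_of_disjoint hdisj, Finset.card_image_of_injOn,
      Finset.card_image_of_injOn, Finset.card_product, leaves, List.length_append, pow_add,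
      ← ihl hl, ← ihr hr]
    · ring
    · rintro ⟨u, v⟩ hp ⟨u', v'⟩ hp' he
      simp only [Finset.coe_product, Set.mem_prod, Finset.mem_coe] at hp hp' he
      have := List.append_inj he ((perm_leaves_of_mem_words hp.2).trans
        (perm_leaves_of_mem_words hp'.2).symm).length_eq
      simp [this]
    · rintro ⟨u, v⟩ hp ⟨u', v'⟩ hp' he
      simp only [Finset.coe_product, Set.mem_prod, Finset.mem_coe] at hp hp' he
      have := List.append_inj he ((perm_leaves_of_mem_words hp.1).trans
        (perm_leaves_of_mem_words hp'.1).symm).length_eq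
      simp [this]

theorem words_relabel (f : ℕ → ℕ) (t : BTree) :
    (t.relabel f).words = t.words.image (List.map f) := by
  induction t with
  | leaf a => simp [words, relabel]
  | node l r ihl ihr =>
    ext w
    simp only [words, relabel, ihl, ihr, Finset.mem_union, Finset.mem_image, Finset.mem_product,
      Prod.exists]
    constructor
    · rintro (⟨_, _, ⟨⟨u, hu, rfl⟩, ⟨v, hv, rfl⟩⟩, rfl⟩ | ⟨_, _, ⟨⟨u, hu, rfl⟩, ⟨v, hv, rfl⟩⟩, rfl⟩)
      · exact ⟨u ++ v, Or.inl ⟨u, v, ⟨hu, hv⟩, rfl⟩, by simp⟩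
      · exact ⟨v ++ u, Or.inr ⟨u, v, ⟨hu, hv⟩, rfl⟩, by simp⟩
    · rintro ⟨_, ⟨u, v, ⟨hu, hv⟩, rfl⟩ | ⟨u, v, ⟨hu, hv⟩, rfl⟩, rfl⟩
      · exact Or.inl ⟨_, _, ⟨⟨u, hu, rfl⟩, ⟨v, hv, rfl⟩⟩, by simp⟩
      · exact Or.inr ⟨_, _, ⟨⟨u, hu, rfl⟩, ⟨v, hv, rfl⟩⟩, by simp⟩

end BTree

theorem map_inj_of_injOn {f : ℕ → ℕ} {s : Set ℕ} (hf : Set.InjOn f s) {u v : List ℕ}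
    (hu : ∀ a ∈ u, a ∈ s) (hv : ∀ a ∈ v, a ∈ s) (h : u.map f = v.map f) : u = v := by
  induction u generalizing v with
  | nil => simpa using h.symm
  | cons a u ih =>
    cases v with
    | nil => simp at h
    | cons b v =>
      simp only [List.map_cons, List.cons.injEq, List.mem_cons, forall_eq_or_imp] at h hu hv
      rw [hf hu.1 hv.1 h.1, ih hu.2 hv.2 h.2]

theorem altCount_relabel {f : ℕ → ℕ} {t : BTree} (hf : Set.InjOn f {a | a ∈ t.leaves}) :
    altCount (t.relabel f) = (t.words.filter fun w => IsAlternating (w.map f)).card := by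
  rw [altCount, BTree.words_relabel, Finset.filter_image, Finset.card_image_of_injOn]
  intro u hu v hv huv
  simp only [Finset.coe_filter, Set.mem_ofPred_eq] at hu hv
  have hu' := (BTree.perm_leaves_of_mem_words hu.1).subset
  have hv' := (BTree.perm_leaves_of_mem_words hv.1).subset
  exact map_inj_of_injOn hf (fun _ h => hu' h) (fun _ h => hv' h) huv

theorem permRelabel_succ {n : ℕ} (σ : Equiv.Perm (Fin n)) (i : Fin n) :
    permRelabel σ (i + 1) = σ i + 1 := by
  simp [permRelabel]

theorem injOn_permRelabel {n : ℕ} (σ : Equiv.Perm (Fin n)) :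
    Set.InjOn (permRelabel σ) {a | a ∈ List.range' 1 n} := by
  intro a ha b hb hab
  simp only [List.mem_range'_1, Set.mem_ofPred_eq] at ha hb
  have ha' : a - 1 < n := by omega
  have hb' : b - 1 < n := by omega
  simp only [permRelabel, ha', hb', dite_true, add_left_inj, Fin.val_inj,
    EmbeddingLike.apply_eq_iff_eq, Fin.mk.injEq] at hab
  omega

theorem isAlternating_map_iff {f : ℕ → ℕ} (hf : StrictMono f) (w : List ℕ) :
    IsAlternating (w.map f) ↔ IsAlternating w := by
  simp only [IsAlternating, List.length_map]
  refine and_congr (forall₂_congr fun i hi => ?_) (forall₂_congr fun i hi => ?_)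
  · have h : i < w.length := by omega
    simp [List.getD_eq_getElem?_getD, h, hi, hf.injective.eq_iff]
  · have h : i < w.length := by omega
    have h' : i + 1 < w.length := by omega
    simp [List.getD_eq_getElem?_getD, h, h', hi, hf.lt_iff_lt]

theorem exists_perm_of_perm_range' {n : ℕ} {w : List ℕ} (hw : w.Perm (List.range' 1 n)) :
    ∃ τ : Equiv.Perm (Fin n), w = List.ofFn fun i => (τ i : ℕ) + 1 := by
  have hlen : w.length = n := by simpa using hw.length_eq
  subst hlen
  have hnd : w.Nodup := hw.nodup_iff.2 List.nodup_range'
  have hmem (i : Fin w.length) : 1 ≤ w[i] ∧ w[i] < 1 + w.length :=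
    List.mem_range'_1.1 (hw.subset (List.getElem_mem i.2))
  let g : Fin w.length → Fin w.length := fun i => ⟨w[i] - 1, by have := hmem i; omega⟩
  have hg : Function.Injective g := by
    intro i j hij
    have hi := hmem i
    have hj := hmem j
    have : w[i] = w[j] := by
      have := congrArg Fin.val hij
      simp only [g] at this
      omega
    exact Fin.ext ((hnd.getElem_inj_iff).1 this)
  refine ⟨Equiv.ofBijective g (Finite.injective_iff_bijective.1 hg), ?_⟩
  conv_lhs => rw [← List.ofFn_getElem (xs := w)]
  congr 1
  funext i
  have := hmem i
  simp only [Equiv.ofBijective_apply, g]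
  simp only [Fin.getElem_fin] at this ⊢
  omega

theorem card_isAlternating_map_permRelabel {n : ℕ} {w : List ℕ}
    (hw : w.Perm (List.range' 1 n)) :
    (Finset.univ.filter fun σ : Equiv.Perm (Fin n) =>
      IsAlternating (w.map (permRelabel σ))).card = altPerms n := by
  obtain ⟨τ, rfl⟩ := exists_perm_of_perm_range' hw
  rw [altPerms, Nat.card_eq_fintype_card, Fintype.card_subtype]
  refine Finset.card_equiv (Equiv.mulRight τ) fun σ => ?_
  simp only [Finset.mem_filter, Finset.mem_univ, true_and, Equiv.coe_mulRight,
    Equiv.Perm.mul_apply]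
  rw [← isAlternating_map_iff (f := fun a => a + 1) (fun a b h => by simpa using h)
    (List.ofFn fun i => (σ (τ i) : ℕ))]
  simp [List.map_ofFn, Function.comp_def, permRelabel_succ]

/-- For any fixed tree shape with `n ≥ 1` leaves labeled bijectively by `{1,…,n}`, the
sum over all `n!` bijective labelings of the number of alternating words in the
expansion equals `2^{n-1} Ẽ_n`; equivalently, the expected number of alternating
monomials, averaged over the permutations of the variables, is `2^{n-1} Ẽ_n / n!`. -/
theorem sum_altCount_over_labelings (n : ℕ) (hn : 1 ≤ n) (t : BTree)
    (ht : t.leaves.Perm (List.range' 1 n)) :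
    ∑ σ : Equiv.Perm (Fin n), altCount (t.relabel (permRelabel σ)) =
      2 ^ (n - 1) * altPerms n := by
  have hnd : t.leaves.Nodup := ht.nodup_iff.2 List.nodup_range'
  have hset : {a | a ∈ t.leaves} = {a | a ∈ List.range' 1 n} := by
    ext a
    exact ht.mem_iff
  have hcard : t.words.card = 2 ^ (n - 1) := by
    have h := BTree.two_mul_card_words hnd
    obtain ⟨m, rfl⟩ := Nat.exists_eq_add_of_le' hn
    rw [ht.length_eq, List.length_range', pow_succ] at h
    rw [Nat.add_sub_cancel]
    omega
  calc ∑ σ : Equiv.Perm (Fin n), altCount (t.relabel (permRelabel σ))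
      = ∑ σ : Equiv.Perm (Fin n),
          (t.words.filter fun w => IsAlternating (w.map (permRelabel σ))).card :=
        Finset.sum_congr rfl fun σ _ => altCount_relabel (hset ▸ injOn_permRelabel σ)
    _ = ∑ w ∈ t.words, (Finset.univ.filter fun σ : Equiv.Perm (Fin n) =>
          IsAlternating (w.map (permRelabel σ))).card :=
        Finset.sum_card_bipartiteAbove_eq_sum_card_bipartiteBelow _
    _ = ∑ _w ∈ t.words, altPerms n :=
        Finset.sum_congr rfl fun w hw =>
          card_isAlternating_map_permRelabel ((BTree.perm_leaves_of_mem_words hw).trans ht)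
    _ = 2 ^ (n - 1) * altPerms n := by rw [Finset.sum_const, hcard, smul_eq_mul]
end
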